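/- Let G be a finite simple connected graph of order n with λ(G) = 2. Then 3 ≤ n ≤ 5 and η(G) = 2. -/

import Mathlib

open SimpleGraph

variable {V : Type*}

/-- `D` is a dominating set of `G`: every vertex outside `D` has a neighbor in `D`. -/
def Dominating (G : SimpleGraph V) (D : Set V) : Prop :=
  ∀ v ∉ D, ∃ u ∈ D, G.Adj u v

/-- `S` is a locating set of `G`: distinct vertices have distinct vectors of
distances to the vertices of `S`. -/
def Locating (G : SimpleGraph V) (S : Set V) : Prop :=
  ∀ u v : V, u ≠ v → ∃ x ∈ S, G.dist u x ≠ G.dist v x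

/-- `D` is a locating-dominating set of `G`: it is dominating and distinct vertices
outside `D` have distinct (nonempty) neighborhoods within `D`. -/
def LocatingDominating (G : SimpleGraph V) (D : Set V) : Prop :=
  Dominating G D ∧
  ∀ u ∉ D, ∀ v ∉ D, u ≠ v → (G.neighborSet u ∩ D) ≠ (G.neighborSet v ∩ D)

/-- The domination number `γ(G)`. -/
noncomputable def domNum (G : SimpleGraph V) : ℕ :=
  sInf {k | ∃ D : Set V, Dominating G D ∧ D.ncard = k}

/-- The metric dimension `β(G)`. -/
noncomputable def metricDim (G : SimpleGraph V) : ℕ :=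
  sInf {k | ∃ S : Set V, Locating G S ∧ S.ncard = k}

/-- The metric-location-domination number `η(G)`. -/
noncomputable def mldNum (G : SimpleGraph V) : ℕ :=
  sInf {k | ∃ S : Set V, Dominating G S ∧ Locating G S ∧ S.ncard = k}

/-- The location-domination number `λ(G)`. -/
noncomputable def locDomNum (G : SimpleGraph V) : ℕ :=
  sInf {k | ∃ D : Set V, LocatingDominating G D ∧ D.ncard = k}

/-- A locating-dominating set of size `k` in a finite graph leaves at most `2 ^ k - 1`
vertices outside of it. -/
theorem LocatingDominating.card_le [Fintype V] {G : SimpleGraph V} {D : Set V}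
    (h : LocatingDominating G D) : Fintype.card V + 1 ≤ D.ncard + 2 ^ D.ncard := by
  have hle : Dᶜ.ncard ≤ (𝒫 D \ {∅}).ncard := by
    refine Set.ncard_le_ncard_of_injOn (fun v => G.neighborSet v ∩ D) ?_ ?_ (Set.toFinite _)
    · intro v hv
      refine ⟨Set.inter_subset_right, fun he => ?_⟩
      obtain ⟨u, hu, huv⟩ := h.1 v hv
      exact Set.eq_empty_iff_forall_notMem.mp he u ⟨huv.symm, hu⟩
    · intro u hu v hv huv
      by_contra hne
      exact h.2 u hu v hv hne huv
  have hdiff := Set.ncard_sdiff_singleton_add_one (show ∅ ∈ 𝒫 D from Set.empty_subset D) (Set.toFinite _)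
  rw [Set.ncard_powerset] at hdiff
  have hcompl := Set.ncard_add_ncard_compl D
  rw [Nat.card_eq_fintype_card] at hcompl
  omega

theorem LocatingDominating.locating {G : SimpleGraph V} (hG : G.Connected) {D : Set V}
    (h : LocatingDominating G D) : Locating G D := by
  intro u v huv
  by_cases hu : u ∈ D
  · exact ⟨u, hu, by simpa using (hG.pos_dist_of_ne huv.symm).ne⟩
  by_cases hv : v ∈ D
  · exact ⟨v, hv, by simpa using (hG.pos_dist_of_ne huv).ne'⟩
  by_contra! hx
  refine h.2 u hu v hv huv (Set.ext fun x => and_congr_left fun hxD => ?_)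
  simp only [mem_neighborSet, ← dist_eq_one_iff_adj, hx x hxD]

theorem Dominating.locatingDominating_of_locating {G : SimpleGraph V} {x : V}
    (hd : Dominating G {x}) (hl : Locating G {x}) : LocatingDominating G {x} := by
  refine ⟨hd, fun u hu v hv huv => ?_⟩
  obtain ⟨_, rfl, hne⟩ := hl u v huv
  obtain ⟨_, rfl, hau⟩ := hd u hu
  obtain ⟨_, rfl, hav⟩ := hd v hv
  exact absurd ((dist_eq_one_iff_adj.mpr hau.symm).trans (dist_eq_one_iff_adj.mpr hav.symm).symm)
    hne

theorem Dominating.nonempty [Nonempty V] {G : SimpleGraph V} {D : Set V} (h : Dominating G D) :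
    D.Nonempty := by
  obtain ⟨v⟩ := ‹Nonempty V›
  by_cases hv : v ∈ D
  · exact ⟨v, hv⟩
  · obtain ⟨u, hu, -⟩ := h v hv
    exact ⟨u, hu⟩

/-- In a connected graph on at most two vertices, every singleton is locating-dominating. -/
theorem locatingDominating_singleton_of_card_le_two [Fintype V] {G : SimpleGraph V}
    (hG : G.Connected) (hc : Fintype.card V ≤ 2) (x : V) : LocatingDominating G {x} := by
  have key : ∀ u v : V, u ≠ x → v ≠ x → u = v := by
    intro u v hu hv
    by_contra huv
    exact absurd (Fintype.two_lt_card_iff.mpr ⟨u, v, x, huv, hu, hv⟩) (by omega)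
  refine ⟨fun v hv => ⟨x, rfl, ?_⟩, fun u hu v hv huv => absurd (key u v hu hv) huv⟩
  have : Nontrivial V := ⟨v, x, hv⟩
  obtain ⟨w, hw⟩ := hG.preconnected.exists_adj_of_nontrivial v
  by_cases hwx : w = x
  · exact hwx ▸ hw.symm
  · exact absurd (key v w hv hwx) hw.ne

theorem stmt13 [Fintype V] (G : SimpleGraph V) (hG : G.Connected)
    (hl : locDomNum G = 2) :
    (3 ≤ Fintype.card V ∧ Fintype.card V ≤ 5) ∧ mldNum G = 2 := by
  have : Nonempty V := hG.nonempty
  have hsingle (x : V) : ¬ LocatingDominating G {x} := fun h => by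
    have : locDomNum G ≤ 1 := Nat.sInf_le ⟨{x}, h, Set.ncard_singleton x⟩
    omega
  obtain ⟨D, hD, hDcard⟩ : 2 ∈ {k | ∃ D : Set V, LocatingDominating G D ∧ D.ncard = k} :=
    hl ▸ Nat.sInf_mem (Nat.nonempty_of_pos_sInf (show 0 < locDomNum G by omega))
  refine ⟨⟨?_, ?_⟩, le_antisymm (Nat.sInf_le ⟨D, hD.1, hD.locating hG, hDcard⟩) ?_⟩
  · by_contra hc
    obtain ⟨x⟩ := hG.nonempty
    exact hsingle x (locatingDominating_singleton_of_card_le_two hG (by omega) x)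
  · have := hD.card_le
    rw [hDcard] at this
    omega
  · refine le_csInf ⟨2, D, hD.1, hD.locating hG, hDcard⟩ ?_
    rintro k ⟨S, hS, hSl, rfl⟩
    by_contra hlt
    have hpos := (Set.ncard_pos (Set.toFinite S)).mpr hS.nonempty
    obtain ⟨x, rfl⟩ := Set.ncard_eq_one.mp (show S.ncard = 1 by omega)
    exact hsingle x (hS.locatingDominating_of_locating hSl)
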